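/- For every real t > 2, one has 2t²·log t + (π²/2)·t + (1/4)·log t < t^{3/2}·( ∫_{1}^{t−1} (log u)·√u/(t−u)² du + ∫_{t+1}^{∞} (log u)·√u/(t−u)² du ) < 2t²·log t + (π²/2)·t + (1/4)·log t + 0.6. -/

import Mathlib

open scoped Real
open Real Filter Topology

/-- The area hyperbolic tangent, continued to `1 < y` through `Real.log y = log |y|`. -/
noncomputable def areaTanh (y : ℝ) : ℝ := (log (1 + y) - log (1 - y)) / 2

/-- The Legendre chi function of order two. -/
noncomputable def legendreChi (y : ℝ) : ℝ := ∑' k : ℕ, y ^ (2 * k + 1) / (2 * k + 1 : ℝ) ^ 2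

theorem summable_one_div_odd_sq : Summable fun k : ℕ => 1 / (2 * k + 1 : ℝ) ^ 2 := by
  have h := (hasSum_zeta_two.summable).comp_injective
    (i := fun k : ℕ => 2 * k + 1) (fun a b h => by simpa using h)
  refine h.congr fun k => ?_
  simp

theorem norm_chi_term_le {y : ℝ} (hy : |y| ≤ 1) (k : ℕ) :
    ‖y ^ (2 * k + 1) / (2 * k + 1 : ℝ) ^ 2‖ ≤ 1 / (2 * k + 1 : ℝ) ^ 2 := by
  rw [norm_div, norm_pow, Real.norm_eq_abs, norm_pow, Real.norm_of_nonneg (by positivity)]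
  gcongr
  exact pow_le_one₀ (abs_nonneg y) hy

theorem hasSum_legendreChi {y : ℝ} (hy : |y| ≤ 1) :
    HasSum (fun k : ℕ => y ^ (2 * k + 1) / (2 * k + 1 : ℝ) ^ 2) (legendreChi y) :=
  (Summable.of_norm_bounded summable_one_div_odd_sq (norm_chi_term_le hy)).hasSum

theorem legendreChi_one : legendreChi 1 = π ^ 2 / 8 := by
  have he : HasSum (fun k : ℕ => 1 / ((2 * k : ℕ) : ℝ) ^ 2) (1 / 4 * (π ^ 2 / 6)) := by
    refine (hasSum_zeta_two.mul_left (1 / 4)).congr_fun fun k => ?_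
    push_cast
    rw [mul_pow, one_div, one_div, mul_inv]
    norm_num
  have ho : HasSum (fun k : ℕ => 1 / ((2 * k + 1 : ℕ) : ℝ) ^ 2) (legendreChi 1) := by
    refine (hasSum_legendreChi (y := 1) (by simp)).congr_fun fun k => ?_
    simp
  have := hasSum_zeta_two.unique
    (HasSum.even_add_odd (f := fun n : ℕ => 1 / (n : ℝ) ^ 2) he ho)
  linarith

theorem continuousOn_legendreChi : ContinuousOn legendreChi (Set.Icc (-1) 1) :=
  continuousOn_tsum (fun k => by fun_prop) summable_one_div_odd_sq
    fun k y hy => norm_chi_term_le (abs_le.2 hy) k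

theorem hasSum_areaTanh {y : ℝ} (hy : |y| < 1) :
    HasSum (fun k : ℕ => y ^ (2 * k + 1) / (2 * k + 1 : ℝ)) (areaTanh y) := by
  refine ((Real.hasSum_log_sub_log_of_abs_lt_one hy).div_const 2).congr_fun fun k => ?_
  ring

theorem hasDerivAt_legendreChi {y : ℝ} (h0 : 0 < y) (h1 : y < 1) :
    HasDerivAt legendreChi (areaTanh y / y) y := by
  obtain ⟨r, hyr, hr⟩ := exists_between h1
  have hr0 : 0 < r := h0.trans hyr
  have hsum : Summable fun k : ℕ => (r ^ 2) ^ k :=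
    summable_geometric_of_lt_one (by positivity) (by nlinarith)
  have key := hasDerivAt_tsum_of_isPreconnected (𝕜 := ℝ) (t := Set.Ioo (-r) r) (y₀ := 0) (y := y)
    (g := fun (k : ℕ) (z : ℝ) => z ^ (2 * k + 1) / (2 * k + 1 : ℝ) ^ 2)
    (g' := fun (k : ℕ) (z : ℝ) => z ^ (2 * k) / (2 * k + 1 : ℝ))
    hsum isOpen_Ioo isPreconnected_Ioo
    (fun k z _ => by
      refine ((hasDerivAt_pow (2 * k + 1) z).div_const _).congr_deriv ?_
      simp only [Nat.add_sub_cancel]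
      push_cast
      field_simp)
    (fun k z hz => by
      have hz' : |z| ≤ r := (abs_lt.2 hz).le
      rw [norm_div, norm_pow, Real.norm_eq_abs, Real.norm_of_nonneg (by positivity), pow_mul]
      have : (1 : ℝ) ≤ 2 * k + 1 := by
        have : (0 : ℝ) ≤ k := by positivity
        linarith
      calc (|z| ^ 2) ^ k / (2 * k + 1 : ℝ) ≤ (|z| ^ 2) ^ k := div_le_self (by positivity) this
        _ ≤ (r ^ 2) ^ k := by gcongr)
    ⟨by linarith, hr0⟩ (hasSum_legendreChi (by simp)).summable ⟨by linarith, hyr⟩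
  refine key.congr_deriv ?_
  have := (hasSum_areaTanh (y := y) (by rw [abs_of_pos h0]; exact h1)).div_const y
  rw [← this.tsum_eq]
  refine tsum_congr fun k => ?_
  field_simp
  ring

theorem hasDerivAt_areaTanh {y : ℝ} (h0 : 0 < y) (h1 : y ≠ 1) :
    HasDerivAt areaTanh (1 / (1 - y ^ 2)) y := by
  have ha : 1 + y ≠ 0 := by positivity
  have hb : 1 - y ≠ 0 := sub_ne_zero.2 h1.symm
  have := ((((hasDerivAt_id y).const_add 1).log ha).sub
    (((hasDerivAt_id y).const_sub 1).log hb)).div_const 2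
  refine this.congr_deriv ?_
  have : 1 - y ^ 2 ≠ 0 := by
    rw [show 1 - y ^ 2 = (1 + y) * (1 - y) by ring]; positivity
  simp only [id]
  field_simp
  ring

theorem areaTanh_inv {y : ℝ} (hy : 1 < y) : areaTanh y⁻¹ = areaTanh y := by
  have h0 : y ≠ 0 := by positivity
  unfold areaTanh
  rw [show 1 + y⁻¹ = (1 + y) / y by field_simp; ring, show 1 - y⁻¹ = -(1 - y) / y by field_simp; ring,
    log_div (by positivity) h0, log_div (by linarith) h0, log_neg_eq_log]
  ring

theorem hasDerivAt_legendreChi_inv {y : ℝ} (hy : 1 < y) :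
    HasDerivAt (fun z => legendreChi z⁻¹) (-(areaTanh y / y)) y := by
  have h0 : 0 < y := by positivity
  have := (hasDerivAt_legendreChi (inv_pos.2 h0) (inv_lt_one_of_one_lt₀ hy)).comp y
    (hasDerivAt_inv h0.ne')
  refine this.congr_deriv ?_
  rw [areaTanh_inv hy]
  field_simp

/-- A primitive of `√x / (1 - x) ^ 2`. -/
noncomputable def sqrtPrimitive (x : ℝ) : ℝ := √x / (1 - x) - areaTanh √x

theorem hasDerivAt_sqrtPrimitive {x : ℝ} (h0 : 0 < x) (h1 : x ≠ 1) :
    HasDerivAt sqrtPrimitive (√x / (1 - x) ^ 2) x := by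
  have hs : 0 < √x := sqrt_pos.2 h0
  have hx : 1 - x ≠ 0 := sub_ne_zero.2 h1.symm
  have hs1 : √x ≠ 1 := by simpa using h1
  have hd := Real.hasDerivAt_sqrt h0.ne'
  have := (hd.div ((hasDerivAt_id x).const_sub 1) hx).sub ((hasDerivAt_areaTanh hs hs1).comp x hd)
  refine this.congr_deriv ?_
  simp only [id]
  rw [sq_sqrt h0.le]
  field_simp
  rw [sq_sqrt h0.le]
  ring

/-- A primitive of `sqrtPrimitive x / x` on `0 < x < 1`, vanishing at `0`. -/
noncomputable def lowerPrimitive (x : ℝ) : ℝ := 2 * areaTanh √x - 2 * legendreChi √x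

/-- A primitive of `sqrtPrimitive x / x` on `1 < x`, vanishing at infinity. -/
noncomputable def upperPrimitive (x : ℝ) : ℝ := 2 * areaTanh √x + 2 * legendreChi (√x)⁻¹

theorem hasDerivAt_lowerPrimitive {x : ℝ} (h0 : 0 < x) (h1 : x < 1) :
    HasDerivAt lowerPrimitive (sqrtPrimitive x / x) x := by
  have hs : 0 < √x := sqrt_pos.2 h0
  have hx : 1 - x ≠ 0 := by linarith
  have hs1 : √x < 1 := (sqrt_lt' one_pos).2 (by simpa using h1)
  have hd := Real.hasDerivAt_sqrt h0.ne'
  have := (((hasDerivAt_areaTanh hs hs1.ne).comp x hd).const_mul 2).sub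
    (((hasDerivAt_legendreChi hs hs1).comp x hd).const_mul 2)
  refine this.congr_deriv ?_
  unfold sqrtPrimitive
  rw [sq_sqrt h0.le]
  field_simp
  rw [sq_sqrt h0.le]

theorem hasDerivAt_upperPrimitive {x : ℝ} (h1 : 1 < x) :
    HasDerivAt upperPrimitive (sqrtPrimitive x / x) x := by
  have h0 : 0 < x := by positivity
  have hs : 0 < √x := sqrt_pos.2 h0
  have hx : 1 - x ≠ 0 := by linarith
  have hs1 : 1 < √x := by rwa [lt_sqrt zero_le_one, one_pow]
  have hd := Real.hasDerivAt_sqrt h0.ne'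
  have := (((hasDerivAt_areaTanh hs hs1.ne').comp x hd).const_mul 2).add
    (((hasDerivAt_legendreChi_inv hs1).comp x hd).const_mul 2)
  refine this.congr_deriv ?_
  unfold sqrtPrimitive
  rw [sq_sqrt h0.le]
  field_simp
  rw [sq_sqrt h0.le]
  ring

theorem hasDerivAt_logPrimitive {H : ℝ → ℝ} {t u : ℝ} (ht : 0 < t) (hu : 0 < u) (hut : u ≠ t)
    (hH : HasDerivAt H (sqrtPrimitive (u / t) / (u / t)) (u / t)) :
    HasDerivAt (fun v => t * (log v * sqrtPrimitive (v / t) - H (v / t)))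
      (t * √t * (log u * √u / (t - u) ^ 2)) u := by
  have hx : 0 < u / t := by positivity
  have hx1 : u / t ≠ 1 := by rwa [Ne, div_eq_one_iff_eq ht.ne']
  have hd : HasDerivAt (fun v : ℝ => v / t) (1 / t) u := (hasDerivAt_id u).div_const t
  have := (((hasDerivAt_log hu.ne').mul ((hasDerivAt_sqrtPrimitive hx hx1).comp u hd)).sub
    (hH.comp u hd)).const_mul t
  refine this.congr_deriv ?_
  have h2 : t - u ≠ 0 := sub_ne_zero.2 hut.symm
  have h3 : √t ≠ 0 := by positivity
  have h4 : 1 - u / t = (t - u) / t := by field_simp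
  simp only [Function.comp]
  rw [h4, sqrt_div hu.le]
  have h5 : t = √t ^ 2 := (sq_sqrt ht.le).symm
  field_simp
  rw [← h5]
  ring

theorem areaTanh_nonneg_of_one_lt {y : ℝ} (hy : 1 < y) : 0 ≤ areaTanh y := by
  unfold areaTanh
  rw [← log_neg_eq_log (1 - y)]
  have : log (-(1 - y)) ≤ log (1 + y) := log_le_log (by linarith) (by linarith)
  linarith

theorem areaTanh_le_of_one_lt {y : ℝ} (hy : 1 < y) : areaTanh y ≤ 1 / (y - 1) := by
  unfold areaTanh
  have h : 0 < y - 1 := by linarith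
  rw [← log_neg_eq_log (1 - y), neg_sub, ← log_div (by linarith) h.ne']
  have := log_le_sub_one_of_pos (x := (1 + y) / (y - 1)) (by positivity)
  have e : (1 + y) / (y - 1) - 1 = 2 * (1 / (y - 1)) := by field_simp; ring
  linarith

theorem abs_sqrtPrimitive_le {x : ℝ} (hx : 4 ≤ x) : |sqrtPrimitive x| ≤ 4 / √x := by
  have hs : 2 ≤ √x := by rw [le_sqrt (by norm_num) (by linarith)]; linarith
  have hsq : √x ^ 2 = x := sq_sqrt (by linarith)
  have h1 : 1 / (√x - 1) ≤ 2 / √x := by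
    rw [div_le_div_iff₀ (by linarith) (by linarith)]; linarith
  have h2 : -(√x / (1 - x)) ≤ 1 / (√x - 1) := by
    rw [← div_neg, neg_sub, div_le_div_iff₀ (by linarith) (by linarith)]; nlinarith
  have h3 : √x / (1 - x) ≤ 0 := div_nonpos_of_nonneg_of_nonpos (by positivity) (by linarith)
  have h4 := areaTanh_nonneg_of_one_lt (y := √x) (by linarith)
  have h5 := areaTanh_le_of_one_lt (y := √x) (by linarith)
  have e : 4 / √x = 2 / √x + 2 / √x := by ring
  unfold sqrtPrimitive
  rw [abs_le]
  constructor <;> linarith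

theorem tendsto_log_mul_sqrtPrimitive {t : ℝ} (ht : 0 < t) :
    Tendsto (fun u => log u * sqrtPrimitive (u / t)) atTop (𝓝 0) := by
  have h0 : Tendsto (fun u : ℝ => log u / u ^ (1 / 2 : ℝ)) atTop (𝓝 0) :=
    (isLittleO_log_rpow_atTop (by norm_num)).tendsto_div_nhds_zero
  have h1 := h0.const_mul (4 * √t)
  rw [mul_zero] at h1
  refine squeeze_zero_norm' ?_ h1
  filter_upwards [eventually_ge_atTop (4 * t), eventually_ge_atTop 1] with u hu hu1
  have h := abs_sqrtPrimitive_le (x := u / t) (by rwa [le_div_iff₀ ht])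
  rw [norm_mul, Real.norm_of_nonneg (log_nonneg hu1), Real.norm_eq_abs, ← sqrt_eq_rpow]
  calc log u * |sqrtPrimitive (u / t)| ≤ log u * (4 / √(u / t)) :=
        mul_le_mul_of_nonneg_left h (log_nonneg hu1)
    _ = 4 * √t * (log u / √u) := by
        rw [sqrt_div (by linarith)]
        have : √t ≠ 0 := by positivity
        have : √u ≠ 0 := by positivity
        field_simp

theorem tendsto_upperPrimitive_atTop : Tendsto upperPrimitive atTop (𝓝 0) := by
  have hT : Tendsto areaTanh atTop (𝓝 0) := by
    have hd : Tendsto (fun y : ℝ => 1 / (y - 1)) atTop (𝓝 0) := by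
      simp only [one_div]
      exact tendsto_inv_atTop_zero.comp (tendsto_atTop_add_const_right _ (-1) tendsto_id)
    refine tendsto_of_tendsto_of_tendsto_of_le_of_le' tendsto_const_nhds hd ?_ ?_
    · filter_upwards [eventually_gt_atTop 1] with y hy using areaTanh_nonneg_of_one_lt hy
    · filter_upwards [eventually_gt_atTop 1] with y hy using areaTanh_le_of_one_lt hy
  have hchi : Tendsto legendreChi (𝓝 0) (𝓝 0) := by
    have : ContinuousAt legendreChi 0 :=
      continuousOn_legendreChi.continuousAt (Icc_mem_nhds (by norm_num) (by norm_num))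
    have h0 : legendreChi 0 = 0 := by simp [legendreChi]
    simpa [ContinuousAt, h0] using this
  have := ((hT.comp tendsto_sqrt_atTop).const_mul 2).add
    ((hchi.comp (tendsto_inv_atTop_zero.comp tendsto_sqrt_atTop)).const_mul 2)
  rw [mul_zero, add_zero] at this
  exact this

theorem integral_lower {t : ℝ} (ht : 2 < t) :
    t * √t * (∫ u in Set.Ioo (1 : ℝ) (t - 1), log u * √u / (t - u) ^ 2) =
      t * (log (t - 1) * sqrtPrimitive ((t - 1) / t) - lowerPrimitive ((t - 1) / t))
        + t * lowerPrimitive (1 / t) := by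
  have ht0 : 0 < t := by linarith
  rw [← MeasureTheory.integral_Ioc_eq_integral_Ioo,
    ← intervalIntegral.integral_of_le (by linarith), ← intervalIntegral.integral_const_mul,
    intervalIntegral.integral_eq_sub_of_hasDerivAt
      (f := fun v => t * (log v * sqrtPrimitive (v / t) - lowerPrimitive (v / t)))]
  · simp
  · intro u hu
    rw [Set.uIcc_of_le (by linarith)] at hu
    have hu0 : 0 < u := by linarith [hu.1]
    have hut : u < t := by linarith [hu.2]
    exact hasDerivAt_logPrimitive ht0 hu0 hut.ne
      (hasDerivAt_lowerPrimitive (by positivity) ((div_lt_one ht0).2 hut))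
  · refine ContinuousOn.intervalIntegrable fun u hu => ContinuousAt.continuousWithinAt ?_
    rw [Set.uIcc_of_le (by linarith)] at hu
    have hu0 : u ≠ 0 := by linarith [hu.1]
    have hut : (t - u) ^ 2 ≠ 0 := pow_ne_zero 2 (by linarith [hu.2])
    fun_prop (disch := assumption)

theorem integral_upper {t : ℝ} (ht : 0 < t) :
    t * √t * (∫ u in Set.Ioi (t + 1), log u * √u / (t - u) ^ 2) =
      -(t * (log (t + 1) * sqrtPrimitive ((t + 1) / t) - upperPrimitive ((t + 1) / t))) := by
  rw [← MeasureTheory.integral_const_mul,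
    MeasureTheory.integral_Ioi_of_hasDerivAt_of_nonneg' (l := 0)
      (g := fun v => t * (log v * sqrtPrimitive (v / t) - upperPrimitive (v / t)))]
  · simp
  · intro u hu
    have hut : t < u := by linarith [Set.mem_Ici.1 hu]
    exact hasDerivAt_logPrimitive ht (ht.trans hut) hut.ne'
      (hasDerivAt_upperPrimitive ((one_lt_div ht).2 hut))
  · intro u hu
    have := log_nonneg (x := u) (by linarith [Set.mem_Ioi.1 hu])
    positivity
  · have := ((tendsto_log_mul_sqrtPrimitive ht).sub
      (tendsto_upperPrimitive_atTop.comp (tendsto_id.atTop_div_const ht))).const_mul t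
    simpa using this

/-- Twice the even part of `log (1 + s) * √(1 + s)`. -/
noncomputable def evenLogSqrt (s : ℝ) : ℝ := log (1 + s) * √(1 + s) + log (1 - s) * √(1 - s)

theorem hasDerivAt_log_mul_sqrt {x : ℝ} (hx : 0 < x) :
    HasDerivAt (fun x => log x * √x) ((2 + log x) / (2 * √x)) x := by
  refine ((hasDerivAt_log hx.ne').mul (Real.hasDerivAt_sqrt hx.ne')).congr_deriv ?_
  have : √x ≠ 0 := by positivity
  field_simp
  rw [sq_sqrt hx.le]
  ring

theorem hasDerivAt_two_add_log_div_sqrt {x : ℝ} (hx : 0 < x) :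
    HasDerivAt (fun x => (2 + log x) / (2 * √x)) (-log x / (4 * √x ^ 3)) x := by
  have : √x ≠ 0 := by positivity
  refine (((hasDerivAt_log hx.ne').const_add 2).div
    ((Real.hasDerivAt_sqrt hx.ne').const_mul 2) (by positivity)).congr_deriv ?_
  field_simp
  rw [sq_sqrt hx.le]
  ring

theorem hasDerivAt_evenLogSqrt {s : ℝ} (h0 : -1 < s) (h1 : s < 1) :
    HasDerivAt evenLogSqrt
      ((2 + log (1 + s)) / (2 * √(1 + s)) - (2 + log (1 - s)) / (2 * √(1 - s))) s := by
  have hp := (hasDerivAt_log_mul_sqrt (x := 1 + s) (by linarith)).comp s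
    ((hasDerivAt_id s).const_add 1)
  have hm := (hasDerivAt_log_mul_sqrt (x := 1 - s) (by linarith)).comp s
    ((hasDerivAt_id s).const_sub 1)
  exact (hp.add hm).congr_deriv (by ring)

theorem deriv_evenLogSqrt_nonneg {s : ℝ} (h0 : 0 ≤ s) (h1 : s < 1) :
    0 ≤ (2 + log (1 + s)) / (2 * √(1 + s)) - (2 + log (1 - s)) / (2 * √(1 - s)) := by
  set f : ℝ → ℝ := fun s =>
    (2 + log (1 + s)) / (2 * √(1 + s)) - (2 + log (1 - s)) / (2 * √(1 - s)) with hf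
  have hd : ∀ s ∈ Set.Ico (0 : ℝ) 1, HasDerivAt f
      (-log (1 + s) / (4 * √(1 + s) ^ 3) + -log (1 - s) / (4 * √(1 - s) ^ 3)) s := by
    intro s hs
    have hp := (hasDerivAt_two_add_log_div_sqrt (x := 1 + s) (by linarith [hs.1])).comp s
      ((hasDerivAt_id s).const_add 1)
    have hm := (hasDerivAt_two_add_log_div_sqrt (x := 1 - s) (by linarith [hs.2])).comp s
      ((hasDerivAt_id s).const_sub 1)
    exact (hp.sub hm).congr_deriv (by ring)
  have hmono : MonotoneOn f (Set.Ico 0 1) := by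
    refine monotoneOn_of_deriv_nonneg (convex_Ico 0 1)
      (fun x hx => (hd x hx).continuousAt.continuousWithinAt)
      (fun x hx => (hd x (interior_subset hx)).differentiableAt.differentiableWithinAt)
      fun x hx => ?_
    have hx := interior_subset hx
    rw [(hd x hx).deriv]
    have ha : 0 < √(1 - x) := sqrt_pos.2 (by linarith [hx.2])
    have hb : √(1 - x) ≤ √(1 + x) := sqrt_le_sqrt (by linarith [hx.1])
    have hlog : log (1 + x) ≤ -log (1 - x) := by
      have : log ((1 + x) * (1 - x)) ≤ 0 :=
        log_nonpos (mul_nonneg (by linarith [hx.1]) (by linarith [hx.2])) (by nlinarith [sq_nonneg x])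
      rw [log_mul (by linarith [hx.1]) (by linarith [hx.2])] at this
      linarith
    have hlog0 : 0 ≤ log (1 + x) := log_nonneg (by linarith [hx.1])
    have : log (1 + x) / (4 * √(1 + x) ^ 3) ≤ -log (1 - x) / (4 * √(1 - x) ^ 3) := by
      gcongr
      linarith
    rw [neg_div]
    linarith
  simpa [hf] using hmono ⟨le_rfl, one_pos⟩ ⟨h0, h1⟩ h0

theorem evenLogSqrt_nonneg {s : ℝ} (h0 : 0 ≤ s) (h1 : s < 1) : 0 ≤ evenLogSqrt s := by
  have hmono : MonotoneOn evenLogSqrt (Set.Ico 0 1) := by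
    have hd : ∀ x ∈ Set.Ico (0 : ℝ) 1, HasDerivAt evenLogSqrt _ x := fun x hx =>
      hasDerivAt_evenLogSqrt (by linarith [hx.1]) hx.2
    refine monotoneOn_of_deriv_nonneg (convex_Ico 0 1)
      (fun x hx => (hd x hx).continuousAt.continuousWithinAt)
      (fun x hx => (hd x (interior_subset hx)).differentiableAt.differentiableWithinAt)
      fun x hx => ?_
    have hx := interior_subset hx
    rw [(hd x hx).deriv]
    exact deriv_evenLogSqrt_nonneg hx.1 hx.2
  simpa [evenLogSqrt] using hmono ⟨le_rfl, one_pos⟩ ⟨h0, h1⟩ h0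

theorem log_mul_sqrt_le {x : ℝ} (hx : 1 ≤ x) : log x * √x ≤ x - 1 := by
  have hs : 0 < √x := by positivity
  have h := self_le_sinh_iff.2 (log_nonneg (x := √x) (by rwa [one_le_sqrt]))
  rw [sinh_log hs, log_sqrt (by linarith)] at h
  have : log x ≤ √x - (√x)⁻¹ := by linarith
  calc log x * √x ≤ (√x - (√x)⁻¹) * √x := by gcongr
    _ = √x ^ 2 - 1 := by field_simp
    _ = x - 1 := by rw [sq_sqrt (by linarith)]

theorem evenLogSqrt_le {s : ℝ} (h0 : 0 ≤ s) (h1 : s ≤ 1 / 2) : evenLogSqrt s ≤ s ^ 3 / 2 := by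
  have hp := log_mul_sqrt_le (x := 1 + s) (by linarith)
  have hl : s + s ^ 2 / 2 + s ^ 3 / 3 ≤ -log (1 - s) := by
    have := sum_le_hasSum (Finset.range 3) (fun i _ => by positivity)
      (hasSum_pow_div_log_of_abs_lt_one (x := s) (by rw [abs_of_nonneg h0]; linarith))
    norm_num [Finset.sum_range_succ] at this
    linarith
  have hs : 1 - s / 2 - s ^ 2 / 5 ≤ √(1 - s) := by
    refine le_sqrt_of_sq_le ?_
    nlinarith [mul_nonneg (sq_nonneg s) (sub_nonneg.2 h1),
      mul_nonneg (pow_nonneg h0 3) (sub_nonneg.2 h1)]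
  have := mul_le_mul hl hs (by nlinarith) (le_trans (by positivity) hl)
  unfold evenLogSqrt
  nlinarith [mul_nonneg (pow_nonneg h0 3) (sub_nonneg.2 h1),
    mul_nonneg (pow_nonneg h0 4) (sub_nonneg.2 h1)]

theorem areaTanh_sqrt_one_sub {h : ℝ} (h0 : 0 < h) (h1 : h < 1) :
    areaTanh √(1 - h) = log (1 + √(1 - h)) - log h / 2 := by
  have hw : √(1 - h) ^ 2 = 1 - h := sq_sqrt (by linarith)
  have hp : 0 < 1 + √(1 - h) := by positivity
  unfold areaTanh
  rw [show 1 - √(1 - h) = h / (1 + √(1 - h)) by field_simp; linarith, log_div h0.ne' hp.ne']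
  ring

theorem areaTanh_sqrt_one_add {h : ℝ} (h0 : 0 < h) :
    areaTanh √(1 + h) = log (1 + √(1 + h)) - log h / 2 := by
  have hw : √(1 + h) ^ 2 = 1 + h := sq_sqrt (by linarith)
  have hp : 0 < 1 + √(1 + h) := by positivity
  unfold areaTanh
  rw [show 1 - √(1 + h) = -(h / (1 + √(1 + h))) by field_simp; linarith, log_neg_eq_log,
    log_div h0.ne' hp.ne']
  ring

/-- The error of removing the interval `(1 - h, 1 + h)` from the principal value integral
of `log x * √x / (1 - x) ^ 2` over the positive half-line. -/
noncomputable def principalValueError (h : ℝ) : ℝ :=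
  log (1 - h) * sqrtPrimitive (1 - h) - lowerPrimitive (1 - h)
    - (log (1 + h) * sqrtPrimitive (1 + h) - upperPrimitive (1 + h)) - π ^ 2 / 2

theorem hasDerivAt_principalValueError {h : ℝ} (h0 : 0 < h) (h1 : h < 1) :
    HasDerivAt principalValueError (-(evenLogSqrt h / h ^ 2)) h := by
  have hm := (hasDerivAt_logPrimitive (H := lowerPrimitive) (t := 1) (u := 1 - h) one_pos
    (by linarith) (by linarith)
    (by simpa using hasDerivAt_lowerPrimitive (x := 1 - h) (by linarith) (by linarith))).comp h
    ((hasDerivAt_id h).const_sub 1)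
  have hp := (hasDerivAt_logPrimitive (H := upperPrimitive) (t := 1) (u := 1 + h) one_pos
    (by linarith) (by linarith)
    (by simpa using hasDerivAt_upperPrimitive (x := 1 + h) (by linarith))).comp h
    ((hasDerivAt_id h).const_add 1)
  have := (hm.sub hp).sub_const (π ^ 2 / 2)
  simp only [Function.comp_def, div_one, one_mul] at this
  refine this.congr_deriv ?_
  unfold evenLogSqrt
  simp
  ring

theorem principalValueError_eq {h : ℝ} (h0 : 0 < h) (h1 : h < 1) :
    principalValueError h = evenLogSqrt h / h
      + (log (1 + h) * log (1 + √(1 + h)) - log (1 - h) * log (1 + √(1 - h)))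
      + log h * (log (1 - h) - log (1 + h)) / 2
      + 2 * (log (1 + √(1 + h)) - log (1 + √(1 - h)))
      + 2 * (legendreChi √(1 - h) + legendreChi (√(1 + h))⁻¹ - 2 * legendreChi 1) := by
  unfold principalValueError sqrtPrimitive lowerPrimitive upperPrimitive evenLogSqrt
  rw [areaTanh_sqrt_one_sub h0 h1, areaTanh_sqrt_one_add h0, legendreChi_one, show 1 - (1 - h) = h by ring,
    show 1 - (1 + h) = -h by ring]
  field_simp
  ring

theorem tendsto_principalValueError : Tendsto principalValueError (𝓝[>] 0) (𝓝 0) := by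
  have hev : ∀ᶠ h : ℝ in 𝓝[>] 0, h ∈ Set.Ioo (0 : ℝ) (1 / 2) :=
    Ioo_mem_nhdsGT (by norm_num)
  have c1 : Tendsto (fun h => evenLogSqrt h / h) (𝓝[>] 0) (𝓝 0) := by
    refine tendsto_of_tendsto_of_tendsto_of_le_of_le' tendsto_const_nhds
      (tendsto_nhdsWithin_of_tendsto_nhds (Continuous.tendsto' (f := fun h : ℝ => h ^ 2 / 2)
        (by fun_prop) 0 0 (by simp))) ?_ ?_
    · filter_upwards [hev] with h hh
      exact div_nonneg (evenLogSqrt_nonneg hh.1.le (by linarith [hh.2])) hh.1.le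
    · filter_upwards [hev] with h hh
      rw [div_le_iff₀ hh.1]
      exact (evenLogSqrt_le hh.1.le hh.2.le).trans_eq (by ring)
  have c2 : Tendsto (fun h : ℝ => log (1 + h) * log (1 + √(1 + h)) -
      log (1 - h) * log (1 + √(1 - h))) (𝓝[>] 0) (𝓝 0) := by
    have : ContinuousAt (fun h : ℝ => log (1 + h) * log (1 + √(1 + h)) -
      log (1 - h) * log (1 + √(1 - h))) 0 := by
      fun_prop (disch := norm_num)
    simpa [ContinuousAt] using this.continuousWithinAt (s := Set.Ioi 0).tendsto
  have c3 : Tendsto (fun h : ℝ => log h * (log (1 - h) - log (1 + h)) / 2) (𝓝[>] 0) (𝓝 0) := by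
    refine tendsto_of_tendsto_of_tendsto_of_le_of_le' tendsto_const_nhds
      (tendsto_nhdsWithin_of_tendsto_nhds (Continuous.tendsto'
        (f := fun h : ℝ => -(3 / 2) * (h * log h))
        (continuous_const.mul continuous_mul_log) 0 0 (by simp))) ?_ ?_
    · filter_upwards [hev] with h hh
      have a1 : log h ≤ 0 := log_nonpos hh.1.le (by linarith [hh.2])
      have a2 : log (1 - h) ≤ log (1 + h) := log_le_log (by linarith [hh.2]) (by linarith [hh.1])
      nlinarith
    · filter_upwards [hev] with h hh
      have a1 : log h ≤ 0 := log_nonpos hh.1.le (by linarith [hh.2])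
      have a2 : log (1 + h) ≤ h := by
        linarith [log_le_sub_one_of_pos (x := 1 + h) (by linarith [hh.1])]
      have a3 : -(2 * h) ≤ log (1 - h) := by
        have h1 : 0 < 1 - h := by linarith [hh.2]
        refine le_trans ?_ (one_sub_inv_le_log_of_pos h1)
        rw [show 1 - (1 - h)⁻¹ = -(h / (1 - h)) by field_simp; ring, neg_le_neg_iff,
          div_le_iff₀ h1]
        nlinarith [hh.1, hh.2]
      nlinarith
  have c4 : Tendsto (fun h : ℝ => 2 * (log (1 + √(1 + h)) - log (1 + √(1 - h))))
      (𝓝[>] 0) (𝓝 0) := by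
    have : ContinuousAt (fun h : ℝ => 2 * (log (1 + √(1 + h)) - log (1 + √(1 - h)))) 0 := by
      fun_prop (disch := norm_num)
    simpa [ContinuousAt] using this.continuousWithinAt (s := Set.Ioi 0).tendsto
  have hchi : Tendsto legendreChi (𝓝[Set.Icc (-1) 1] 1) (𝓝 (legendreChi 1)) :=
    continuousOn_legendreChi 1 (by norm_num)
  have c5 : Tendsto (fun h : ℝ => legendreChi √(1 - h)) (𝓝[>] 0) (𝓝 (legendreChi 1)) := by
    refine hchi.comp (tendsto_nhdsWithin_iff.2 ⟨tendsto_nhdsWithin_of_tendsto_nhds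
      (Continuous.tendsto' (by fun_prop) 0 1 (by simp)), ?_⟩)
    filter_upwards [hev] with h hh
    exact ⟨by linarith [sqrt_nonneg (1 - h)], sqrt_le_one.2 (by linarith [hh.1])⟩
  have c6 : Tendsto (fun h : ℝ => legendreChi (√(1 + h))⁻¹) (𝓝[>] 0) (𝓝 (legendreChi 1)) := by
    have hc : ContinuousAt (fun h : ℝ => (√(1 + h))⁻¹) 0 := by fun_prop (disch := norm_num)
    refine hchi.comp (tendsto_nhdsWithin_iff.2 ⟨?_, ?_⟩)
    · simpa [ContinuousAt] using hc.continuousWithinAt (s := Set.Ioi 0).tendsto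
    filter_upwards [hev] with h hh
    have : 0 ≤ (√(1 + h))⁻¹ := by positivity
    exact ⟨by linarith, inv_le_one_of_one_le₀ (one_le_sqrt.2 (by linarith [hh.1]))⟩
  have := (((c1.add c2).add c3).add c4).add
    (((c5.add c6).sub_const (2 * legendreChi 1)).const_mul 2)
  have e : 0 + 0 + 0 + 0 + 2 * (legendreChi 1 + legendreChi 1 - 2 * legendreChi 1) = 0 := by ring
  rw [e] at this
  refine this.congr' ?_
  filter_upwards [hev] with h hh
  exact (principalValueError_eq hh.1 (by linarith [hh.2])).symm

theorem principalValueError_nonpos {h : ℝ} (h0 : 0 < h) (h1 : h ≤ 1 / 2) :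
    principalValueError h ≤ 0 := by
  have hd : ∀ x ∈ Set.Ioc (0 : ℝ) (1 / 2), HasDerivAt principalValueError _ x := fun x hx =>
    hasDerivAt_principalValueError hx.1 (by linarith [hx.2])
  have hmono : AntitoneOn principalValueError (Set.Ioc 0 (1 / 2)) := by
    refine antitoneOn_of_deriv_nonpos (convex_Ioc _ _)
      (fun x hx => (hd x hx).continuousAt.continuousWithinAt)
      (fun x hx => (hd x (interior_subset hx)).differentiableAt.differentiableWithinAt)
      fun x hx => ?_
    have hx := interior_subset hx
    rw [(hd x hx).deriv, neg_nonpos]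
    exact div_nonneg (evenLogSqrt_nonneg hx.1.le (by linarith [hx.2])) (sq_nonneg x)
  refine ge_of_tendsto tendsto_principalValueError ?_
  filter_upwards [Ioo_mem_nhdsGT h0] with x hx
  exact hmono ⟨hx.1, by linarith [hx.2]⟩ ⟨h0, h1⟩ hx.2.le

theorem neg_sq_div_four_le_principalValueError {h : ℝ} (h0 : 0 < h) (h1 : h ≤ 1 / 2) :
    -(h ^ 2 / 4) ≤ principalValueError h := by
  have hd : ∀ x ∈ Set.Ioc (0 : ℝ) (1 / 2), HasDerivAt (fun x => principalValueError x + x ^ 2 / 4)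
      (-(evenLogSqrt x / x ^ 2) + x / 2) x := fun x hx =>
    ((hasDerivAt_principalValueError hx.1 (by linarith [hx.2])).add
      ((hasDerivAt_pow 2 x).div_const 4)).congr_deriv (by push_cast; ring)
  have hmono : MonotoneOn (fun x => principalValueError x + x ^ 2 / 4) (Set.Ioc 0 (1 / 2)) := by
    refine monotoneOn_of_deriv_nonneg (convex_Ioc _ _)
      (fun x hx => (hd x hx).continuousAt.continuousWithinAt)
      (fun x hx => (hd x (interior_subset hx)).differentiableAt.differentiableWithinAt)
      fun x hx => ?_
    have hx := interior_subset hx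
    rw [(hd x hx).deriv]
    have : evenLogSqrt x / x ^ 2 ≤ x / 2 := by
      rw [div_le_iff₀ (pow_pos hx.1 2)]
      exact (evenLogSqrt_le hx.1.le hx.2).trans_eq (by ring)
    linarith
  have hlim : Tendsto (fun x => principalValueError x + x ^ 2 / 4) (𝓝[>] 0) (𝓝 0) := by
    have := tendsto_principalValueError.add (tendsto_nhdsWithin_of_tendsto_nhds
      (s := Set.Ioi 0) (Continuous.tendsto' (f := fun h : ℝ => h ^ 2 / 4)
        (by fun_prop) 0 0 (by simp)))
    simpa using this
  have : 0 ≤ principalValueError h + h ^ 2 / 4 := by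
    refine le_of_tendsto hlim ?_
    filter_upwards [Ioo_mem_nhdsGT h0] with x hx
    exact hmono ⟨hx.1, by linarith [hx.2]⟩ ⟨h0, h1⟩ hx.2.le
  linarith

theorem hasSum_lowerPrimitive {x : ℝ} (h0 : 0 ≤ x) (h1 : x < 1) :
    HasSum (fun k : ℕ => 4 * k / (2 * k + 1 : ℝ) ^ 2 * (√x * x ^ k)) (lowerPrimitive x) := by
  have hs : |√x| < 1 := by
    rw [abs_of_nonneg (sqrt_nonneg x)]; exact (sqrt_lt' one_pos).2 (by simpa using h1)
  refine (((hasSum_areaTanh hs).mul_left 2).sub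
    ((hasSum_legendreChi hs.le).mul_left 2)).congr_fun fun k => ?_
  rw [pow_succ √x, pow_mul, sq_sqrt h0]
  field_simp
  ring

theorem le_lowerPrimitive {x : ℝ} (h0 : 0 ≤ x) (h1 : x < 1) :
    4 / 9 * (√x * x) ≤ lowerPrimitive x := by
  have := le_hasSum (hasSum_lowerPrimitive h0 h1) 1 fun k _ => by positivity
  norm_num at this
  linarith

theorem lowerPrimitive_le {x : ℝ} (h0 : 0 ≤ x) (h1 : x < 1) :
    lowerPrimitive x ≤ 4 / 9 * (√x * x) + 8 / 25 * (√x * x ^ 2 / (1 - x)) := by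
  have hg := (hasSum_geometric_of_lt_one h0 h1).mul_left (8 / 25 * (√x * x ^ 2))
  have hs := (hasSum_nat_add_iff' 2).2 (hasSum_lowerPrimitive h0 h1)
  have := hasSum_le (fun k => ?_) hs hg
  · norm_num [Finset.sum_range_succ] at this
    rw [div_eq_mul_inv (√x * x ^ 2)]
    linarith
  · push_cast
    have : 4 * (k + 2 : ℝ) / (2 * (k + 2) + 1) ^ 2 ≤ 8 / 25 := by
      rw [div_le_div_iff₀ (by positivity) (by norm_num)]
      have : (0 : ℝ) ≤ k := by positivity
      nlinarith
    calc 4 * (k + 2 : ℝ) / (2 * (k + 2) + 1) ^ 2 * (√x * x ^ (k + 2))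
        ≤ 8 / 25 * (√x * x ^ (k + 2)) := by gcongr
      _ = 8 / 25 * (√x * x ^ 2) * x ^ k := by ring

theorem sqrt_one_add_mul_sqrt_one_sub {h : ℝ} (h0 : -1 ≤ h) :
    √(1 + h) * √(1 - h) = √(1 - h ^ 2) := by
  rw [← sqrt_mul (by linarith)]
  ring_nf

theorem sqrt_one_add_add_sqrt_one_sub_sq {h : ℝ} (h0 : -1 ≤ h) (h1 : h ≤ 1) :
    (√(1 + h) + √(1 - h)) ^ 2 = 2 + 2 * √(1 - h ^ 2) := by
  rw [add_sq, sq_sqrt (by linarith), sq_sqrt (by linarith), mul_assoc,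
    sqrt_one_add_mul_sqrt_one_sub h0]
  ring

theorem sqrt_one_add_add_sqrt_one_sub_le {h : ℝ} (h0 : 0 ≤ h) (h1 : h ≤ 1 / 2) :
    √(1 + h) + √(1 - h) ≤ 2 - h ^ 2 / 4 := by
  have hp : √(1 - h ^ 2) ≤ 1 - h ^ 2 / 2 := by
    refine sqrt_le_iff.2 ⟨by nlinarith, by nlinarith [sq_nonneg (h ^ 2)]⟩
  refine (sq_le_sq₀ (by positivity) (by nlinarith)).1 ?_
  rw [sqrt_one_add_add_sqrt_one_sub_sq (by linarith) (by linarith)]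
  nlinarith [sq_nonneg (h ^ 2)]

theorem le_sqrt_one_add_add_sqrt_one_sub {h : ℝ} (h0 : 0 ≤ h) (h1 : h ≤ 1 / 2) :
    2 - h ^ 2 / 4 - h ^ 4 / 8 ≤ √(1 + h) + √(1 - h) := by
  have hz : h ^ 2 ≤ 1 / 4 := by nlinarith
  have hz0 := sq_nonneg h
  have e : h ^ 4 = (h ^ 2) ^ 2 := by ring
  rw [e]
  have hp : 1 - h ^ 2 / 2 - (h ^ 2) ^ 2 / 6 ≤ √(1 - h ^ 2) := by
    refine le_sqrt_of_sq_le ?_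
    generalize h ^ 2 = z at *
    nlinarith [mul_nonneg (sq_nonneg z) (sub_nonneg.2 hz),
      mul_nonneg (pow_nonneg hz0 3) (sub_nonneg.2 hz)]
  refine (sq_le_sq₀ (by nlinarith) (by positivity)).1 ?_
  rw [sqrt_one_add_add_sqrt_one_sub_sq (by linarith) (by linarith)]
  generalize h ^ 2 = z at *
  nlinarith [mul_nonneg (sq_nonneg z) (sub_nonneg.2 hz),
      mul_nonneg (pow_nonneg hz0 3) (sub_nonneg.2 hz)]

theorem hasDerivAt_log_one_add_sqrt {x : ℝ} (hx : 0 < x) :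
    HasDerivAt (fun x => log (1 + √x)) (1 / (2 * √x * (1 + √x))) x := by
  have h : 1 + √x ≠ 0 := by positivity
  refine (((Real.hasDerivAt_sqrt hx.ne').const_add 1).log h).congr_deriv ?_
  field_simp

theorem hasDerivAt_log_sqrt_ratio {h : ℝ} (h0 : 0 < h) (h1 : h < 1) :
    HasDerivAt (fun h => log (1 + √(1 + h)) - log (1 + √(1 - h)))
      (1 / (√(1 - h ^ 2) * (√(1 + h) + √(1 - h)))) h := by
  have hp := (hasDerivAt_log_one_add_sqrt (x := 1 + h) (by linarith)).comp h
    ((hasDerivAt_id h).const_add 1)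
  have hm := (hasDerivAt_log_one_add_sqrt (x := 1 - h) (by linarith)).comp h
    ((hasDerivAt_id h).const_sub 1)
  refine (hp.sub hm).congr_deriv ?_
  rw [← sqrt_one_add_mul_sqrt_one_sub (by linarith)]
  have ha : 0 < √(1 + h) := sqrt_pos.2 (by linarith)
  have hb : 0 < √(1 - h) := sqrt_pos.2 (by linarith)
  have hsum : √(1 + h) ^ 2 + √(1 - h) ^ 2 = 2 := by
    rw [sq_sqrt (by linarith), sq_sqrt (by linarith)]; ring
  generalize √(1 + h) = a at *
  generalize √(1 - h) = b at *
  field_simp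
  linear_combination (a + b + 1) * hsum

theorem log_sqrt_ratio_bounds {h : ℝ} (h0 : 0 ≤ h) (h1 : h ≤ 1 / 2) :
    h / 2 ≤ log (1 + √(1 + h)) - log (1 + √(1 - h)) ∧
      log (1 + √(1 + h)) - log (1 + √(1 - h)) ≤ h / 2 + 3 / 20 * h ^ 3 := by
  set f : ℝ → ℝ := fun h => log (1 + √(1 + h)) - log (1 + √(1 - h)) with hf
  have hcont : ContinuousOn f (Set.Icc 0 (1 / 2)) := by
    refine ContinuousOn.sub (ContinuousOn.log (by fun_prop) fun x _ => by positivity)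
      (ContinuousOn.log (by fun_prop) fun x _ => by positivity)
  have hd : ∀ x ∈ interior (Set.Icc (0 : ℝ) (1 / 2)), HasDerivAt f _ x := fun x hx => by
    rw [interior_Icc] at hx
    exact hasDerivAt_log_sqrt_ratio hx.1 (by linarith [hx.2])
  have f0 : f 0 = 0 := by simp [hf]
  have hmem0 : (0 : ℝ) ∈ Set.Icc (0 : ℝ) (1 / 2) := by norm_num
  constructor
  · have hd' : ∀ x ∈ interior (Set.Icc (0 : ℝ) (1 / 2)), HasDerivAt (fun x => f x - x / 2) _ x :=
      fun x hx => (hd x hx).sub ((hasDerivAt_id x).div_const 2)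
    have hmono : MonotoneOn (fun x => f x - x / 2) (Set.Icc 0 (1 / 2)) := by
      refine monotoneOn_of_deriv_nonneg (convex_Icc _ _) (hcont.sub (by fun_prop))
        (fun x hx => (hd' x hx).differentiableAt.differentiableWithinAt) fun x hx => ?_
      rw [(hd' x hx).deriv, sub_nonneg]
      have hx := interior_subset hx
      have hs := sqrt_one_add_add_sqrt_one_sub_le hx.1 hx.2
      have hp : √(1 - x ^ 2) ≤ 1 := sqrt_le_one.2 (by nlinarith)
      have hp0 : 0 < √(1 - x ^ 2) := sqrt_pos.2 (by nlinarith [hx.1, hx.2])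
      have hs0 : 0 < √(1 + x) + √(1 - x) :=
        add_pos_of_pos_of_nonneg (sqrt_pos.2 (by linarith [hx.1])) (sqrt_nonneg _)
      refine one_div_le_one_div_of_le (by positivity) ?_
      nlinarith [sq_nonneg x]
    have := hmono hmem0 ⟨h0, h1⟩ h0
    simp only [f0] at this
    linarith
  · have hd' : ∀ x ∈ interior (Set.Icc (0 : ℝ) (1 / 2)),
        HasDerivAt (fun x => f x - (x / 2 + 3 / 20 * x ^ 3)) _ x :=
      fun x hx => (hd x hx).sub (((hasDerivAt_id x).div_const 2).add
        ((hasDerivAt_pow 3 x).const_mul (3 / 20)))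
    have hmono : AntitoneOn (fun x => f x - (x / 2 + 3 / 20 * x ^ 3)) (Set.Icc 0 (1 / 2)) := by
      refine antitoneOn_of_deriv_nonpos (convex_Icc _ _) (hcont.sub (by fun_prop))
        (fun x hx => (hd' x hx).differentiableAt.differentiableWithinAt) fun x hx => ?_
      rw [(hd' x hx).deriv, sub_nonpos]
      have hx := interior_subset hx
      have hz : x ^ 2 ≤ 1 / 4 := by nlinarith [hx.1, hx.2]
      have hz0 := sq_nonneg x
      have hs := le_sqrt_one_add_add_sqrt_one_sub hx.1 hx.2
      have e : x ^ 4 = (x ^ 2) ^ 2 := by ring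
      rw [e] at hs
      have hp : 1 - 27 / 50 * x ^ 2 ≤ √(1 - x ^ 2) := by
        refine le_sqrt_of_sq_le ?_
        nlinarith
      have hps := mul_le_mul hp hs (by nlinarith) (sqrt_nonneg _)
      have hpos : 0 < √(1 - x ^ 2) * (√(1 + x) + √(1 - x)) :=
        lt_of_lt_of_le (mul_pos (by nlinarith) (by nlinarith)) hps
      rw [div_le_iff₀ hpos]
      refine le_trans ?_ (mul_le_mul_of_nonneg_left hps (by positivity))
      push_cast
      generalize x ^ 2 = z at *
      nlinarith [mul_nonneg hz0 (sub_nonneg.2 hz),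
        mul_nonneg (sq_nonneg z) (sub_nonneg.2 hz),
        mul_nonneg (pow_nonneg hz0 3) (sub_nonneg.2 hz)]
    have := hmono hmem0 ⟨h0, h1⟩ h0
    simp only [f0] at this
    linarith

theorem log_coefficient_bounds {h : ℝ} (h0 : 0 < h) (h1 : h ≤ 1 / 2) :
    -(h ^ 3 / 8) ≤ sqrtPrimitive (1 - h) - sqrtPrimitive (1 + h) - 2 / h - h / 4 ∧
      sqrtPrimitive (1 - h) - sqrtPrimitive (1 + h) - 2 / h - h / 4 ≤ 3 / 20 * h ^ 3 := by
  have e : sqrtPrimitive (1 - h) - sqrtPrimitive (1 + h) - 2 / h - h / 4 =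
      (√(1 + h) + √(1 - h) - 2) / h + (log (1 + √(1 + h)) - log (1 + √(1 - h))) - h / 4 := by
    unfold sqrtPrimitive
    rw [areaTanh_sqrt_one_sub h0 (by linarith), areaTanh_sqrt_one_add h0,
      show 1 - (1 - h) = h by ring, show 1 - (1 + h) = -h by ring]
    field_simp
    ring
  obtain ⟨hl, hu⟩ := log_sqrt_ratio_bounds h0.le h1
  have hs : (√(1 + h) + √(1 - h) - 2) / h ≤ -h / 4 := by
    rw [div_le_iff₀ h0]
    linarith [sqrt_one_add_add_sqrt_one_sub_le h0.le h1]
  have hs' : -h / 4 - h ^ 3 / 8 ≤ (√(1 + h) + √(1 - h) - 2) / h := by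
    rw [le_div_iff₀ h0]
    linarith [le_sqrt_one_add_add_sqrt_one_sub h0.le h1]
  rw [e]
  constructor <;> linarith

theorem lowerPrimitive_le_of_le_half {h : ℝ} (h0 : 0 < h) (h1 : h ≤ 1 / 2) :
    lowerPrimitive h ≤ 11 / 20 * h := by
  have hs : √h ≤ 71 / 100 := by
    refine sqrt_le_iff.2 ⟨by norm_num, by linarith⟩
  have hd : √h * h ^ 2 / (1 - h) ≤ √h * h := by
    rw [div_le_iff₀ (by linarith)]
    nlinarith [mul_nonneg (mul_nonneg (sqrt_nonneg h) h0.le) (sub_nonneg.2 h1)]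
  have := lowerPrimitive_le h0.le (by linarith)
  nlinarith

theorem rpow_three_halves {t : ℝ} (ht : 0 < t) : t ^ ((3 : ℝ) / 2) = t * √t := by
  rw [sqrt_eq_rpow, show (3 : ℝ) / 2 = 1 + 1 / 2 by norm_num, rpow_add ht, rpow_one]

theorem rpow_mul_integrals_eq {t : ℝ} (ht : 2 < t) :
    t ^ ((3 : ℝ) / 2) * ((∫ u in Set.Ioo (1 : ℝ) (t - 1), log u * √u / (t - u) ^ 2)
        + ∫ u in Set.Ioi (t + 1), log u * √u / (t - u) ^ 2) =
      2 * t ^ 2 * log t + π ^ 2 / 2 * t + 1 / 4 * log t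
        + t * (log t * (sqrtPrimitive (1 - 1 / t) - sqrtPrimitive (1 + 1 / t)
            - 2 / (1 / t) - 1 / t / 4)
          + lowerPrimitive (1 / t) + principalValueError (1 / t)) := by
  have ht0 : 0 < t := by linarith
  have h1 : 1 / t < 1 := by rw [div_lt_one ht0]; linarith
  have h0 : 0 < 1 / t := by positivity
  have em : t - 1 = t * (1 - 1 / t) := by field_simp
  have ep : t + 1 = t * (1 + 1 / t) := by field_simp
  have dm : (t - 1) / t = 1 - 1 / t := by field_simp
  have dp : (t + 1) / t = 1 + 1 / t := by field_simp
  have lm : log (t - 1) = log t + log (1 - 1 / t) := by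
    rw [em, log_mul ht0.ne' (by linarith)]
  have lp : log (t + 1) = log t + log (1 + 1 / t) := by
    rw [ep, log_mul ht0.ne' (by linarith)]
  rw [rpow_three_halves ht0, mul_add, integral_lower ht, integral_upper ht0, dm, dp, lm, lp]
  unfold principalValueError
  field_simp
  ring

theorem integral_log_sqrt_bound (t : ℝ) (ht : 2 < t) :
    2 * t^2 * Real.log t + (π^2/2) * t + (1/4) * Real.log t
        < t ^ ((3 : ℝ)/2) *
          ((∫ u in Set.Ioo (1 : ℝ) (t - 1), Real.log u * Real.sqrt u / (t - u)^2)
            + ∫ u in Set.Ioi (t + 1), Real.log u * Real.sqrt u / (t - u)^2) ∧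
      t ^ ((3 : ℝ)/2) *
          ((∫ u in Set.Ioo (1 : ℝ) (t - 1), Real.log u * Real.sqrt u / (t - u)^2)
            + ∫ u in Set.Ioi (t + 1), Real.log u * Real.sqrt u / (t - u)^2)
        < 2 * t^2 * Real.log t + (π^2/2) * t + (1/4) * Real.log t + 0.6 := by
  have ht0 : 0 < t := by linarith
  rw [rpow_mul_integrals_eq ht]
  have h0 : 0 < 1 / t := by positivity
  have h1 : 1 / t ≤ 1 / 2 := one_div_le_one_div_of_le two_pos ht.le
  have hth : t * (1 / t) = 1 := by field_simp
  have hL0 : 0 ≤ log t := log_nonneg (by linarith)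
  have hL : log t * (1 / t) ≤ 1 - 1 / t := by
    have := mul_le_mul_of_nonneg_right (log_le_sub_one_of_pos ht0) h0.le
    rwa [sub_mul, hth, one_mul] at this
  obtain ⟨hcl, hcu⟩ := log_coefficient_bounds h0 h1
  have hQl := neg_sq_div_four_le_principalValueError h0 h1
  have hQu := principalValueError_nonpos h0 h1
  have hPl := le_lowerPrimitive h0.le (by linarith)
  have hPu := lowerPrimitive_le_of_le_half h0 h1
  have hs : 1 / t ≤ √(1 / t) := le_sqrt_of_sq_le (by nlinarith)
  generalize sqrtPrimitive (1 - 1 / t) - sqrtPrimitive (1 + 1 / t)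
    - 2 / (1 / t) - 1 / t / 4 = c at *
  generalize principalValueError (1 / t) = q at *
  generalize lowerPrimitive (1 / t) = p at *
  generalize 1 / t = h at *
  have hcl' := mul_le_mul_of_nonneg_left hcl hL0
  have hcu' := mul_le_mul_of_nonneg_left hcu hL0
  have hLh := mul_le_mul_of_nonneg_right hL (sq_nonneg h)
  have hl : 0 < log t * c + p + q := by
    nlinarith [mul_le_mul_of_nonneg_right hs h0.le, pow_pos h0 2, pow_pos h0 3]
  have hu : log t * c + p + q < 3 / 5 * h := by
    nlinarith [mul_nonneg h0.le (sq_nonneg (h - 1 / 2))]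
  have hu' := mul_lt_mul_of_pos_left hu ht0
  have := mul_pos ht0 hl
  constructor
  · linarith
  · have e : t * (3 / 5 * h) = 0.6 := by linear_combination (3 / 5) * hth
    linarith
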